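/- Fix positive integers p and q, and for n ≥ 1 write r = pn and s = qn. Then, as n → ∞, the ratio of the Delannoy number D(r,s) to ( (√(r²+s²) − s)/r )^{−r} · ( (√(r²+s²) − r)/s )^{−s} · √( r·s / ( 2π·(r+s−√(r²+s²))²·√(r²+s²) ) ) tends to 1. -/

import Mathlib

open Filter Topology

/-- The Delannoy numbers: D(0,0) = 1, with D(r,s) = D(r−1,s) + D(r,s−1) + D(r−1,s−1)
and D(r,s) = 0 when r < 0 or s < 0. -/
def delannoy : ℕ → ℕ → ℕ
  | 0, 0 => 1
  | 0, s + 1 => delannoy 0 s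
  | r + 1, 0 => delannoy r 0
  | r + 1, s + 1 => delannoy r (s + 1) + delannoy (r + 1) s + delannoy r s

theorem ne_of_mem_sphere {ρ : ℝ} (h0 : 0 < ρ) (h1 : ρ < 1) {z : ℂ}
    (hz : z ∈ Metric.sphere (0 : ℂ) ρ) : z ≠ 0 ∧ 1 - z ≠ 0 := by
  rw [mem_sphere_zero_iff_norm] at hz
  refine ⟨fun h => ?_, fun h => ?_⟩
  · rw [h, norm_zero] at hz; linarith
  · rw [← sub_eq_zero.mp h, norm_one] at hz; linarith

theorem circleIntegrable_delannoy {ρ : ℝ} (h0 : 0 < ρ) (h1 : ρ < 1) (r s t : ℕ) :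
    CircleIntegrable (fun z : ℂ => (1 + z) ^ s / (1 - z) ^ t / z ^ r) 0 ρ := by
  refine ContinuousOn.circleIntegrable h0.le fun z hz => ?_
  obtain ⟨hz0, hz1⟩ := ne_of_mem_sphere h0 h1 hz
  refine ContinuousAt.continuousWithinAt ?_
  fun_prop (disch := simp [hz0, hz1])

/-- Cauchy's formula for the coefficient of `z ^ r` in `(1 + z) ^ s / (1 - z) ^ (s + 1)`. -/
theorem circleIntegral_eq_delannoy {ρ : ℝ} (h0 : 0 < ρ) (h1 : ρ < 1) (r s : ℕ) :
    (∮ z in C(0, ρ), (1 + z) ^ s / (1 - z) ^ (s + 1) / z ^ (r + 1)) =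
      2 * Real.pi * Complex.I * (delannoy r s : ℂ) := by
  have hzero (s : ℕ) : (∮ z in C(0, ρ), (1 + z) ^ s / (1 - z) ^ (s + 1) / z ^ (0 + 1)) =
      2 * Real.pi * Complex.I := by
    have hd : DifferentiableOn ℂ (fun z : ℂ => (1 + z) ^ s / (1 - z) ^ (s + 1))
        (Metric.closedBall 0 ρ) := by
      intro z hz
      have hz1 : 1 - z ≠ 0 := by
        intro h
        rw [mem_closedBall_zero_iff, ← sub_eq_zero.mp h, norm_one] at hz
        linarith
      refine DifferentiableAt.differentiableWithinAt ?_
      fun_prop (disch := simp [hz1])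
    have := hd.circleIntegral_sub_inv_smul (Metric.mem_ball_self h0)
    simpa [div_eq_inv_mul] using this
  induction r generalizing s with
  | zero =>
    rw [hzero]
    have : delannoy 0 s = 1 := by
      induction s with
      | zero => simp [delannoy]
      | succ s ih => simpa [delannoy] using ih
    simp [this]
  | succ r ihr =>
    induction s with
    | zero =>
      have key : (∮ z in C(0, ρ), ((1 + z) ^ 0 / (1 - z) ^ (0 + 1) / z ^ (r + 1 + 1) -
          (1 + z) ^ 0 / (1 - z) ^ (0 + 1) / z ^ (r + 1))) =
          ∮ z in C(0, ρ), (z - 0) ^ (-(r + 2 : ℤ)) := by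
        refine circleIntegral.integral_congr h0.le fun z hz => ?_
        obtain ⟨hz0, hz1⟩ := ne_of_mem_sphere h0 h1 hz
        have : (z - 0) ^ (-(r + 2 : ℤ)) = (z ^ (r + 2))⁻¹ := by
          rw [sub_zero, zpow_neg]; norm_cast
        simp only [this]
        field_simp
        ring
      rw [circleIntegral.integral_sub (circleIntegrable_delannoy h0 h1 _ _ _)
        (circleIntegrable_delannoy h0 h1 _ _ _),
        circleIntegral.integral_sub_zpow_of_ne (by omega), ihr, sub_eq_zero] at key
      rw [key, delannoy]
    | succ s ihs =>
      have key : (∮ z in C(0, ρ), ((1 + z) ^ (s + 1) / (1 - z) ^ (s + 1 + 1) / z ^ (r + 1 + 1) -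
          (1 + z) ^ (s + 1) / (1 - z) ^ (s + 1 + 1) / z ^ (r + 1))) =
          ∮ z in C(0, ρ), ((1 + z) ^ s / (1 - z) ^ (s + 1) / z ^ (r + 1 + 1) +
          (1 + z) ^ s / (1 - z) ^ (s + 1) / z ^ (r + 1)) := by
        refine circleIntegral.integral_congr h0.le fun z hz => ?_
        obtain ⟨hz0, hz1⟩ := ne_of_mem_sphere h0 h1 hz
        field_simp
        ring
      rw [circleIntegral.integral_sub (circleIntegrable_delannoy h0 h1 _ _ _)
        (circleIntegrable_delannoy h0 h1 _ _ _),
        circleIntegral.integral_add (circleIntegrable_delannoy h0 h1 _ _ _)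
        (circleIntegrable_delannoy h0 h1 _ _ _), ihs, ihr, ihr, sub_eq_iff_eq_add] at key
      rw [key, delannoy]
      push_cast
      ring

/-- Laplace's method on `[-a, a]` with a quadratic maximum at `0`. -/
theorem tendsto_sqrt_mul_integral_pow {f g : ℝ → ℂ} {a c v : ℝ} (ha : 0 < a) (hc : 0 < c)
    (hf : Continuous f) (hg : Continuous g)
    (hbound : ∀ θ, |θ| ≤ a → ‖f θ‖ ≤ Real.exp (-c * θ ^ 2))
    (htaylor : (fun θ : ℝ => f θ - 1 + v / 2 * θ ^ 2) =o[𝓝 0] fun θ => θ ^ 2) :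
    Tendsto (fun n : ℕ => (√(n : ℝ) : ℂ) * ∫ θ in (-a)..a, f θ ^ n * g θ) atTop
      (𝓝 (g 0 * √(2 * Real.pi / v))) := by
  obtain ⟨M, hM⟩ := isCompact_Icc.exists_bound_of_continuousOn
    (s := Set.Icc (-a) a) hg.continuousOn
  have hM0 : 0 ≤ M := (norm_nonneg _).trans (hM 0 (by constructor <;> linarith))
  let F : ℕ → ℝ → ℂ := fun n => (Set.Ioc (-a * √(n : ℝ)) (a * √(n : ℝ))).indicator
    fun t => f (t / √(n : ℝ)) ^ n * g (t / √(n : ℝ))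
  have hlim (t : ℝ) : Tendsto (fun n : ℕ => t / √(n : ℝ)) atTop (𝓝 0) :=
    tendsto_const_nhds.div_atTop (Real.tendsto_sqrt_atTop.comp tendsto_natCast_atTop_atTop)
  have hF : Tendsto (fun n => ∫ t, F n t) atTop
      (𝓝 (∫ t : ℝ, ((Real.exp (-(v / 2) * t ^ 2) : ℝ) : ℂ) * g 0)) := by
    refine MeasureTheory.tendsto_integral_of_dominated_convergence
      (fun t => Real.exp (-c * t ^ 2) * M) (fun n => ?_)
      ((integrable_exp_neg_mul_sq hc).mul_const M) (fun n => ?_) ?_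
    · refine MeasureTheory.AEStronglyMeasurable.indicator ?_ measurableSet_Ioc
      exact Continuous.aestronglyMeasurable (by fun_prop)
    · refine MeasureTheory.ae_of_all _ fun t => ?_
      by_cases ht : t ∈ Set.Ioc (-a * √(n : ℝ)) (a * √(n : ℝ))
      · have hn : 0 < √(n : ℝ) := by
          by_contra! h
          have : √(n : ℝ) = 0 := le_antisymm h (Real.sqrt_nonneg _)
          simp [this] at ht
        have hmem : |t / √(n : ℝ)| ≤ a := by
          rw [abs_le, le_div_iff₀ hn, div_le_iff₀ hn]
          exact ⟨ht.1.le, ht.2⟩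
        simp only [F, Set.indicator_of_mem ht, norm_mul, norm_pow]
        gcongr
        · calc ‖f (t / √(n : ℝ))‖ ^ n ≤ Real.exp (-c * (t / √(n : ℝ)) ^ 2) ^ n := by
                gcongr; exact hbound _ hmem
            _ = Real.exp (-c * t ^ 2) := by
                rw [← Real.exp_nat_mul, div_pow, Real.sq_sqrt (Nat.cast_nonneg n)]
                have : (n : ℝ) ≠ 0 := (Real.sqrt_pos.mp hn).ne'
                congr 1
                field_simp
        · exact hM _ (abs_le.mp hmem)
      · simp only [F, Set.indicator_of_notMem ht, norm_zero]
        positivity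
    · refine MeasureTheory.ae_of_all _ fun t => ?_
      have hpow : Tendsto (fun n : ℕ => f (t / √(n : ℝ)) ^ n) atTop
          (𝓝 ((Real.exp (-(v / 2) * t ^ 2) : ℝ) : ℂ)) := by
        have h := htaylor.comp_tendsto (hlim t)
        have h2 : (fun n : ℕ => (n : ℂ) * (f (t / √(n : ℝ)) - 1 +
            v / 2 * ((t / √(n : ℝ) : ℝ) : ℂ) ^ 2)) =o[atTop] fun _ => (1 : ℝ) := by
          have hcast : (fun n : ℕ => (n : ℂ)) =O[atTop] fun n : ℕ => (n : ℝ) :=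
            Asymptotics.isBigO_of_le _ fun n => by simp
          refine (hcast.mul_isLittleO h).trans_isBigO (Asymptotics.IsBigO.of_bound (t ^ 2) ?_)
          filter_upwards [eventually_gt_atTop 0] with n hn
          have hn' : (0 : ℝ) < n := by exact_mod_cast hn
          have : (n : ℝ) * (t / √(n : ℝ)) ^ 2 = t ^ 2 := by
            rw [div_pow, Real.sq_sqrt hn'.le]
            field_simp
          simp [this]
        have h3 := (Asymptotics.isLittleO_one_iff ℝ).mp h2
        have h4 : Tendsto (fun n : ℕ => (n : ℂ) * (f (t / √(n : ℝ)) - 1)) atTop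
            (𝓝 ((-(v / 2) * t ^ 2 : ℝ) : ℂ)) := by
          have := h3.add_const ((-(v / 2) * t ^ 2 : ℝ) : ℂ)
          rw [zero_add] at this
          refine this.congr' ?_
          filter_upwards [eventually_gt_atTop 0] with n hn
          have hn' : (n : ℂ) ≠ 0 := by exact_mod_cast hn.ne'
          have : ((t / √(n : ℝ) : ℝ) : ℂ) ^ 2 = t ^ 2 / n := by
            rw [← Complex.ofReal_pow, div_pow, Real.sq_sqrt (Nat.cast_nonneg n)]
            push_cast; rfl
          rw [this]
          push_cast
          field_simp
          ring
        have := Complex.tendsto_one_add_pow_exp_of_tendsto h4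
        rw [← Complex.ofReal_exp] at this
        simpa using this
      have hgt : Tendsto (fun n : ℕ => g (t / √(n : ℝ))) atTop (𝓝 (g 0)) :=
        (hg.tendsto 0).comp (hlim t)
      refine (hpow.mul hgt).congr' ?_
      have hev : ∀ᶠ n : ℕ in atTop, |t| / a < √(n : ℝ) :=
        (Real.tendsto_sqrt_atTop.comp tendsto_natCast_atTop_atTop).eventually_gt_atTop _
      filter_upwards [hev] with n hn
      rw [div_lt_iff₀' ha] at hn
      have := abs_lt.mp hn
      simp only [F]
      rw [Set.indicator_of_mem]
      exact ⟨by linarith, by linarith⟩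
  rw [MeasureTheory.integral_mul_const, integral_complex_ofReal, integral_gaussian] at hF
  rw [mul_comm, show 2 * Real.pi / v = Real.pi / (v / 2) by field_simp]
  refine hF.congr' ?_
  filter_upwards [eventually_gt_atTop 0] with n hn
  have hn' : 0 < √(n : ℝ) := by positivity
  have h := intervalIntegral.integral_comp_div (a := -a * √(n : ℝ)) (b := a * √(n : ℝ))
    (fun θ => f θ ^ n * g θ) hn'.ne'
  rw [mul_div_cancel_right₀ _ hn'.ne', mul_div_cancel_right₀ _ hn'.ne', Complex.real_smul] at h
  rw [← h, intervalIntegral.integral_of_le (by nlinarith), MeasureTheory.integral_indicator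
    measurableSet_Ioc]

/-- The base of the Cauchy integrand of `delannoy (p * n) (q * n)` on the circle of radius `ρ`,
normalised to equal `1` at `θ = 0`. -/
noncomputable def saddleBase (ρ : ℝ) (p q : ℕ) (θ : ℝ) : ℂ :=
  ((1 + circleMap 0 ρ θ) / (1 - circleMap 0 ρ θ) * ((1 - ρ) / (1 + ρ))) ^ q *
    (ρ / circleMap 0 ρ θ) ^ p

theorem circleMap_zero_ne {ρ : ℝ} (h0 : 0 < ρ) (h1 : ρ < 1) (θ : ℝ) :
    circleMap 0 ρ θ ≠ 0 ∧ 1 - circleMap 0 ρ θ ≠ 0 :=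
  ne_of_mem_sphere h0 h1 (circleMap_mem_sphere 0 h0.le θ)

theorem saddleBase_zero {ρ : ℝ} (h0 : 0 < ρ) (h1 : ρ < 1) (p q : ℕ) :
    saddleBase ρ p q 0 = 1 := by
  have hρ : (ρ : ℂ) ≠ 0 := by exact_mod_cast h0.ne'
  have h2 : (1 - ρ : ℂ) ≠ 0 := by exact_mod_cast (sub_pos.mpr h1).ne'
  have h3 : (1 + ρ : ℂ) ≠ 0 := by exact_mod_cast (by linarith : (0 : ℝ) < 1 + ρ).ne'
  simp only [saddleBase, circleMap_zero, Complex.ofReal_zero, zero_mul, Complex.exp_zero, mul_one]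
  field_simp
  simp

theorem continuous_saddleBase {ρ : ℝ} (h0 : 0 < ρ) (h1 : ρ < 1) (p q : ℕ) :
    Continuous (saddleBase ρ p q) := by
  unfold saddleBase
  fun_prop (disch := intro θ; first
    | exact (circleMap_zero_ne h0 h1 θ).1 | exact (circleMap_zero_ne h0 h1 θ).2)

theorem hasDerivAt_saddleBase {ρ : ℝ} (h0 : 0 < ρ) (h1 : ρ < 1) (p q : ℕ) (θ : ℝ) :
    HasDerivAt (saddleBase ρ p q)
      (saddleBase ρ p q θ * (Complex.I * (q * (2 * circleMap 0 ρ θ) /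
        ((1 - circleMap 0 ρ θ) * (1 + circleMap 0 ρ θ)) - p))) θ := by
  have hz := hasDerivAt_circleMap 0 ρ θ
  obtain ⟨hz0, hz1⟩ := circleMap_zero_ne h0 h1 θ
  have hz2 : 1 + circleMap 0 ρ θ ≠ 0 := by
    intro h
    have h3 := circleMap_mem_sphere 0 h0.le θ
    rw [mem_sphere_zero_iff_norm, eq_neg_of_add_eq_zero_right h, norm_neg, norm_one] at h3
    linarith
  have hu := (((hz.const_add 1).div (hz.const_sub 1) hz1).mul_const
    ((1 - ρ : ℂ) / (1 + ρ))).fun_pow q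
  have hw := ((hasDerivAt_const θ (ρ : ℂ)).div hz hz0).fun_pow p
  refine (hu.mul hw).congr_deriv ?_
  simp only [saddleBase, Pi.div_apply]
  generalize circleMap 0 ρ θ = z at *
  have e1 (x : ℂ) : (q : ℂ) * x ^ (q - 1) * x = q * x ^ q := by
    rcases q with _ | q
    · simp
    · simp [pow_succ, mul_assoc]
  have e2 (x : ℂ) : (p : ℂ) * x ^ (p - 1) * x = p * x ^ p := by
    rcases p with _ | p
    · simp
    · simp [pow_succ, mul_assoc]
  have d1 : (z * Complex.I * (1 - z) - (1 + z) * -(z * Complex.I)) / (1 - z) ^ 2 *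
      ((1 - ρ : ℂ) / (1 + ρ)) = ((1 + z) / (1 - z) * ((1 - ρ) / (1 + ρ))) *
        (Complex.I * (2 * z / ((1 - z) * (1 + z)))) := by
    generalize (1 - ρ : ℂ) / (1 + ρ) = k
    field_simp
    ring
  have d2 : ((0 : ℂ) * z - ρ * (z * Complex.I)) / z ^ 2 = ρ / z * -Complex.I := by
    field_simp
    ring
  rw [d1, d2]
  linear_combination (ρ / z) ^ p * (Complex.I * (2 * z / ((1 - z) * (1 + z)))) * e1
    ((1 + z) / (1 - z) * ((1 - ρ) / (1 + ρ))) - Complex.I *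
      ((1 + z) / (1 - z) * ((1 - ρ) / (1 + ρ))) ^ q * e2 (ρ / z)

theorem saddleBase_taylor {ρ : ℝ} (h0 : 0 < ρ) (h1 : ρ < 1) {p q : ℕ}
    (hs : 2 * q * ρ = p * (1 - ρ ^ 2)) :
    (fun θ : ℝ => saddleBase ρ p q θ - 1 +
      ((p * (1 + ρ ^ 2) / (1 - ρ ^ 2) : ℝ) : ℂ) / 2 * θ ^ 2) =o[𝓝 0] fun θ => θ ^ 2 := by
  set v : ℝ := p * (1 + ρ ^ 2) / (1 - ρ ^ 2) with hv
  have h2 : (1 - ρ : ℂ) ≠ 0 := by exact_mod_cast (sub_pos.mpr h1).ne'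
  have h3 : (1 + ρ : ℂ) ≠ 0 := by exact_mod_cast (by linarith : (0 : ℝ) < 1 + ρ).ne'
  have hsc : (2 * q * ρ : ℂ) = p * (1 - ρ ^ 2) := by exact_mod_cast hs
  have h23 : (1 - ρ ^ 2 : ℂ) = (1 - ρ) * (1 + ρ) := by ring
  set L : ℝ → ℂ := fun θ => Complex.I * (q * (2 * circleMap 0 ρ θ) /
        ((1 - circleMap 0 ρ θ) * (1 + circleMap 0 ρ θ)) - p) with hL
  have hc0 : circleMap 0 ρ 0 = ρ := by simp [circleMap]
  have hL0 : L 0 = 0 := by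
    simp only [hL, hc0]
    field_simp
    linear_combination Complex.I * hsc
  have hLd : HasDerivAt L (-v) 0 := by
    have hz := hasDerivAt_circleMap 0 ρ 0
    have hd := ((((hz.const_mul 2).const_mul (q : ℂ)).div
      ((hz.const_sub 1).mul (hz.const_add 1)) (by
        simpa [hc0] using ⟨h2, h3⟩)).sub_const (p : ℂ)).const_mul Complex.I
    refine hd.congr_deriv ?_
    simp only [hc0, Pi.mul_apply, hv]
    push_cast
    rw [h23]
    field_simp
    linear_combination (-(1 + (ρ : ℂ) ^ 2)) * hsc + 2 * q * ρ * (1 + (ρ : ℂ) ^ 2) * Complex.I_sq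
  have hD : HasDerivAt (fun θ : ℝ => saddleBase ρ p q θ * L θ + v * θ) 0 0 := by
    have h := ((hasDerivAt_saddleBase h0 h1 p q 0).mul hLd).add
      ((Complex.ofRealCLM.hasDerivAt (x := 0)).const_mul (v : ℂ))
    refine h.congr_deriv ?_
    change saddleBase ρ p q 0 * L 0 * L 0 + saddleBase ρ p q 0 * -v + v * _ = 0
    rw [hL0, saddleBase_zero h0 h1]
    simp
  have hlo : (fun θ : ℝ => saddleBase ρ p q θ * L θ + v * θ) =o[𝓝[Set.univ] 0]
      fun θ => (θ - 0) ^ 1 := by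
    have := hD.isLittleO
    simpa [hL0] using this
  have := convex_univ.isLittleO_pow_succ_real (Set.mem_univ 0) (n := 1)
    (f := fun θ : ℝ => saddleBase ρ p q θ - 1 + (v : ℂ) / 2 * θ ^ 2) (fun θ _ => ?_) hlo
  · simpa [saddleBase_zero h0 h1] using this
  · refine HasDerivAt.hasDerivWithinAt ?_
    have h := ((hasDerivAt_saddleBase h0 h1 p q θ).sub_const 1).add
      (((Complex.ofRealCLM.hasDerivAt (x := θ)).fun_pow 2).const_mul ((v : ℂ) / 2))
    refine h.congr_deriv ?_
    simp only [hL, Complex.ofRealCLM_apply, Complex.ofReal_one]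
    push_cast
    ring

theorem norm_saddleBase_le {ρ : ℝ} (h0 : 0 < ρ) (h1 : ρ < 1) {p q : ℕ} {θ : ℝ}
    (hθ : |θ| ≤ Real.pi) :
    ‖saddleBase ρ p q θ‖ ≤
      Real.exp (-(q * (4 * (1 + ρ ^ 2) * ρ / (1 + ρ) ^ 4 / Real.pi ^ 2)) * θ ^ 2) := by
  obtain ⟨hz0, hz1⟩ := circleMap_zero_ne h0 h1 θ
  have hnz : ‖circleMap 0 ρ θ‖ = ρ := by simp [abs_of_pos h0]
  have hcos := Real.cos_le_one_sub_mul_cos_sq hθ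
  have hcos2 := Real.cos_le_one θ
  have hre : (circleMap 0 ρ θ).re = ρ * Real.cos θ := by simp [circleMap, Complex.exp_re]
  have him : (circleMap 0 ρ θ).im = ρ * Real.sin θ := by simp [circleMap, Complex.exp_im]
  have hsq := Real.sin_sq_add_cos_sq θ
  have hplus : ‖1 + circleMap 0 ρ θ‖ ^ 2 = 1 + ρ ^ 2 + 2 * ρ * Real.cos θ := by
    rw [Complex.sq_norm, Complex.normSq_apply, Complex.add_re, Complex.add_im, hre, him]
    simp only [Complex.one_re, Complex.one_im]
    linear_combination ρ ^ 2 * hsq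
  have hminus : ‖1 - circleMap 0 ρ θ‖ ^ 2 = 1 + ρ ^ 2 - 2 * ρ * Real.cos θ := by
    rw [Complex.sq_norm, Complex.normSq_apply, Complex.sub_re, Complex.sub_im, hre, him]
    simp only [Complex.one_re, Complex.one_im]
    linear_combination ρ ^ 2 * hsq
  have hpos : 0 < 1 + ρ ^ 2 - 2 * ρ * Real.cos θ := by
    nlinarith [sq_pos_of_pos (sub_pos.mpr h1)]
  have hbase : ‖(1 + circleMap 0 ρ θ) / (1 - circleMap 0 ρ θ) * ((1 - ρ : ℂ) / (1 + ρ))‖ ≤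
      Real.exp (-(4 * (1 + ρ ^ 2) * ρ / (1 + ρ) ^ 4 / Real.pi ^ 2) * θ ^ 2) := by
    refine le_of_sq_le_sq ?_ (Real.exp_pos _).le
    have e1 : ‖(1 - ρ : ℂ)‖ = 1 - ρ := by
      rw [← Complex.ofReal_one, ← Complex.ofReal_sub, Complex.norm_real, Real.norm_eq_abs,
        abs_of_pos (by linarith)]
    have e2 : ‖(1 + ρ : ℂ)‖ = 1 + ρ := by
      rw [← Complex.ofReal_one, ← Complex.ofReal_add, Complex.norm_real, Real.norm_eq_abs,
        abs_of_pos (by linarith)]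
    rw [norm_mul, norm_div, norm_div, mul_pow, div_pow, div_pow, hplus, hminus, e1, e2,
      ← Real.exp_nat_mul]
    have hA : 4 * (1 + ρ ^ 2) * ρ * (1 - Real.cos θ) / (1 + ρ) ^ 4 ≤
        4 * (1 + ρ ^ 2) * ρ * (1 - Real.cos θ) /
          ((1 + ρ ^ 2 - 2 * ρ * Real.cos θ) * (1 + ρ) ^ 2) := by
      have : 0 ≤ 1 - Real.cos θ := by linarith
      gcongr
      have : 1 + ρ ^ 2 - 2 * ρ * Real.cos θ ≤ (1 + ρ) ^ 2 := by nlinarith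
      calc _ ≤ (1 + ρ) ^ 2 * (1 + ρ) ^ 2 := by gcongr
        _ = _ := by ring
    have hB : 4 * (1 + ρ ^ 2) * ρ / (1 + ρ) ^ 4 * (2 / Real.pi ^ 2 * θ ^ 2) ≤
        4 * (1 + ρ ^ 2) * ρ / (1 + ρ) ^ 4 * (1 - Real.cos θ) := by
      gcongr
      linarith
    calc _ = 1 - 4 * (1 + ρ ^ 2) * ρ * (1 - Real.cos θ) /
          ((1 + ρ ^ 2 - 2 * ρ * Real.cos θ) * (1 + ρ) ^ 2) := by
          have h4 : (1 + ρ ^ 2 - 2 * ρ * Real.cos θ) * (1 + ρ) ^ 2 ≠ 0 := by positivity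
          rw [div_mul_div_comm, eq_sub_iff_add_eq, ← add_div, div_eq_one_iff_eq h4]
          ring
      _ ≤ 1 - 4 * (1 + ρ ^ 2) * ρ / (1 + ρ) ^ 4 * (2 / Real.pi ^ 2 * θ ^ 2) := by
          rw [mul_div_right_comm] at hA
          linarith
      _ ≤ Real.exp (-(4 * (1 + ρ ^ 2) * ρ / (1 + ρ) ^ 4 * (2 / Real.pi ^ 2 * θ ^ 2))) :=
          Real.one_sub_le_exp_neg _
      _ = _ := by
          congr 1
          push_cast
          ring
  have hunit : ‖(ρ : ℂ) / circleMap 0 ρ θ‖ = 1 := by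
    rw [norm_div, hnz, Complex.norm_real, Real.norm_eq_abs, abs_of_pos h0, div_self h0.ne']
  rw [saddleBase, norm_mul, norm_pow, norm_pow, hunit, one_pow, mul_one]
  calc _ ≤ _ := pow_le_pow_left₀ (norm_nonneg _) hbase q
    _ = _ := by
      rw [← Real.exp_nat_mul]
      congr 1
      ring

theorem delannoy_eq_integral_saddleBase {ρ : ℝ} (h0 : 0 < ρ) (h1 : ρ < 1) (p q n : ℕ) :
    (∫ θ in (-Real.pi)..Real.pi, saddleBase ρ p q θ ^ n * (1 - circleMap 0 ρ θ)⁻¹) =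
      2 * Real.pi * ((delannoy (p * n) (q * n) * ρ ^ (p * n) *
        ((1 - ρ) / (1 + ρ)) ^ (q * n) : ℝ) : ℂ) := by
  have hper : Function.Periodic
      (fun θ => saddleBase ρ p q θ ^ n * (1 - circleMap 0 ρ θ)⁻¹) (2 * Real.pi) := by
    intro θ
    simp only [saddleBase, periodic_circleMap 0 ρ θ]
  have hshift := hper.intervalIntegral_add_eq (-Real.pi) 0
  rw [show -Real.pi + 2 * Real.pi = Real.pi by ring, zero_add] at hshift
  have hC := circleIntegral_eq_delannoy h0 h1 (p * n) (q * n)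
  have hI : (∮ z in C(0, ρ), (1 + z) ^ (q * n) / (1 - z) ^ (q * n + 1) / z ^ (p * n + 1)) *
      (ρ ^ (p * n) * ((1 - ρ) / (1 + ρ)) ^ (q * n)) = Complex.I *
      ∫ θ in 0..(2 * Real.pi), saddleBase ρ p q θ ^ n * (1 - circleMap 0 ρ θ)⁻¹ := by
    rw [circleIntegral, ← intervalIntegral.integral_mul_const,
      ← intervalIntegral.integral_const_mul]
    refine intervalIntegral.integral_congr fun θ _ => ?_
    obtain ⟨hz0, hz1⟩ := circleMap_zero_ne h0 h1 θ
    simp only [saddleBase, deriv_circleMap, smul_eq_mul]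
    generalize circleMap 0 ρ θ = z at *
    generalize (1 - ρ : ℂ) / (1 + ρ) = k
    rw [mul_pow, ← pow_mul, ← pow_mul, mul_pow, div_pow, div_pow]
    field_simp
    ring
  rw [hshift]
  refine mul_left_cancel₀ Complex.I_ne_zero ?_
  rw [← hI, hC]
  push_cast
  ring

theorem tendsto_sqrt_mul_delannoy {ρ : ℝ} (h0 : 0 < ρ) (h1 : ρ < 1) {p q : ℕ} (hq : 0 < q)
    (hs : 2 * q * ρ = p * (1 - ρ ^ 2)) :
    Tendsto (fun n : ℕ => √(n : ℝ) * (delannoy (p * n) (q * n) * ρ ^ (p * n) *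
        ((1 - ρ) / (1 + ρ)) ^ (q * n))) atTop
      (𝓝 ((2 * Real.pi)⁻¹ * ((1 - ρ)⁻¹ *
        √(2 * Real.pi / (p * (1 + ρ ^ 2) / (1 - ρ ^ 2)))))) := by
  have hg : Continuous fun θ : ℝ => (1 - circleMap 0 ρ θ)⁻¹ := by
    fun_prop (disch := exact fun θ => (circleMap_zero_ne h0 h1 θ).2)
  have h := tendsto_sqrt_mul_integral_pow Real.pi_pos
    (c := q * (4 * (1 + ρ ^ 2) * ρ / (1 + ρ) ^ 4 / Real.pi ^ 2)) (by positivity)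
    (continuous_saddleBase h0 h1 p q) hg (fun θ hθ => norm_saddleBase_le h0 h1 hθ)
    (saddleBase_taylor h0 h1 hs)
  simp only [delannoy_eq_integral_saddleBase h0 h1] at h
  have h' := h.const_mul ((2 * Real.pi : ℂ)⁻¹)
  rw [← tendsto_ofReal_iff]
  convert h' using 2 with n
  · have : (2 * Real.pi : ℂ) ≠ 0 := by simp [Real.pi_ne_zero]
    push_cast
    field_simp
  · simp [circleMap]

/-- asymptotics of the Delannoy numbers along the ray (pn, qn)
(Example 3.2 of Pemantle–Wilson, "Asymptotics of multivariate sequences I"). -/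
theorem statement14 (p q : ℕ) (hp : 0 < p) (hq : 0 < q) :
    Tendsto (fun n : ℕ =>
        (delannoy (p * n) (q * n) : ℝ) /
          (let r : ℝ := (p * n : ℕ)
           let s : ℝ := (q * n : ℕ)
           let R : ℝ := Real.sqrt (r ^ 2 + s ^ 2)
           ((R - s) / r) ^ (-(p * n : ℤ)) * ((R - r) / s) ^ (-(q * n : ℤ)) *
             Real.sqrt (r * s / (2 * Real.pi * (r + s - R) ^ 2 * R))))
      atTop (𝓝 1) := by
  have hp' : (0 : ℝ) < p := by exact_mod_cast hp
  have hq' : (0 : ℝ) < q := by exact_mod_cast hq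
  set T : ℝ := √((p : ℝ) ^ 2 + (q : ℝ) ^ 2) with hT
  have hTsq : T ^ 2 = (p : ℝ) ^ 2 + (q : ℝ) ^ 2 := Real.sq_sqrt (by positivity)
  have hT0 : 0 < T := Real.sqrt_pos.mpr (by positivity)
  have hqT : q < T := by nlinarith
  have hTpq : T < p + q := by nlinarith
  obtain ⟨ρ, hρ⟩ : ∃ ρ : ℝ, ρ = (T - q) / p := ⟨_, rfl⟩
  have hTρ : T = p * ρ + q := by rw [hρ]; field_simp; ring
  have h0 : 0 < ρ := by rw [hρ]; exact div_pos (by linarith) hp'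
  have h1 : ρ < 1 := by rw [hρ, div_lt_one hp']; linarith
  have hs : 2 * q * ρ = p * (1 - ρ ^ 2) := by
    rw [hTρ] at hTsq
    refine mul_left_cancel₀ hp'.ne' ?_
    linear_combination hTsq
  have hρ1 : 0 < 1 - ρ := by linarith
  have hρ2 : 0 < 1 - ρ ^ 2 := by nlinarith
  have hκ : (T - p) / q = (1 - ρ) / (1 + ρ) := by
    rw [div_eq_div_iff hq'.ne' (by linarith), hTρ]
    linear_combination hs
  have hmain := tendsto_sqrt_mul_delannoy h0 h1 hq hs
  set C : ℝ := (2 * Real.pi)⁻¹ * ((1 - ρ)⁻¹ *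
        √(2 * Real.pi / (p * (1 + ρ ^ 2) / (1 - ρ ^ 2)))) with hC
  have hC0 : 0 < C := by positivity
  have hone := hmain.div_const C
  rw [div_self hC0.ne'] at hone
  refine hone.congr' ?_
  filter_upwards [eventually_gt_atTop 0] with n hn
  have hn' : (0 : ℝ) < n := by exact_mod_cast hn
  have hR : √(((p * n : ℕ) : ℝ) ^ 2 + ((q * n : ℕ) : ℝ) ^ 2) = T * n := by
    rw [Real.sqrt_eq_iff_eq_sq (by positivity) (by positivity)]
    push_cast
    linear_combination -(n : ℝ) ^ 2 * hTsq
  have e1 : (T * n - ((q * n : ℕ) : ℝ)) / ((p * n : ℕ) : ℝ) = ρ := by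
    rw [hTρ]; push_cast; field_simp; ring
  have e2 : (T * n - ((p * n : ℕ) : ℝ)) / ((q * n : ℕ) : ℝ) = (1 - ρ) / (1 + ρ) := by
    rw [← hκ]; push_cast; field_simp
  have e3 : √(((p * n : ℕ) : ℝ) * ((q * n : ℕ) : ℝ) / (2 * Real.pi *
      (((p * n : ℕ) : ℝ) + ((q * n : ℕ) : ℝ) - T * n) ^ 2 * (T * n))) = C / √(n : ℝ) := by
    rw [Real.sqrt_eq_iff_eq_sq (by positivity) (by positivity), hC]
    rw [div_pow, mul_pow, mul_pow, Real.sq_sqrt (by positivity), Real.sq_sqrt hn'.le]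
    have hTq : T * (1 - ρ ^ 2) = q * (1 + ρ ^ 2) := by
      rw [hTρ]; linear_combination (-ρ) * hs
    have : T = q * (1 + ρ ^ 2) / (1 - ρ ^ 2) := by
      rw [eq_div_iff hρ2.ne', hTq]
    have h4 : ((p * n : ℕ) : ℝ) + ((q * n : ℕ) : ℝ) - T * n = p * (1 - ρ) * n := by
      rw [hTρ]; push_cast; ring
    rw [h4, this]
    push_cast
    field_simp
  simp only [hR, e1, e2, e3]
  have z1 : ρ ^ (-(p * n : ℤ)) = (ρ ^ (p * n))⁻¹ := by rw [zpow_neg]; norm_cast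
  have z2 : ((1 - ρ) / (1 + ρ)) ^ (-(q * n : ℤ)) = (((1 - ρ) / (1 + ρ)) ^ (q * n))⁻¹ := by
    rw [zpow_neg]; norm_cast
  rw [z1, z2]
  field_simp
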